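/- Let L be an n×n real Laplacian matrix with eigenprojection L^⊢, and suppose that the kernel of L is one-dimensional (equivalently, the rank of L is n−1; this holds exactly when the dependency digraph contains a spanning in-tree). Then for every distribution vector v ∈ ℝⁿ (vᵢ ≥ 0, Σᵢ vᵢ = 1), one has 𝟏 vᵀ L^⊢ = L^⊢; that is, the latent consensus 𝟏 vᵀ L^⊢ x₀ coincides with the ordinary consensus L^⊢ x₀ for every x₀ ∈ ℝⁿ. -/

import Mathlib

open Matrix Filter Topology

/-- `L` is the Laplacian matrix of a weighted digraph: off-diagonal entries are
nonpositive and every row sum is zero. -/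
def IsLaplacian {m : Type*} [Fintype m] [DecidableEq m] (L : Matrix m m ℝ) : Prop :=
  (∀ i j, i ≠ j → L i j ≤ 0) ∧ (∀ i, ∑ j, L i j = 0)

/-- `P` is the eigenprojection of the square matrix `M` at eigenvalue `0`:
`P` is idempotent, its range is the kernel of `M ^ k` and its kernel is the range
of `M ^ k`, where `k` is the size of the matrix. -/
def IsEigenprojection {m : Type*} [Fintype m] [DecidableEq m] (M P : Matrix m m ℝ) : Prop :=
  P * P = P ∧
  LinearMap.range P.mulVecLin = LinearMap.ker (M ^ Fintype.card m).mulVecLin ∧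
  LinearMap.ker P.mulVecLin = LinearMap.range (M ^ Fintype.card m).mulVecLin

namespace IsLaplacian

variable {m : Type*} [Fintype m] [DecidableEq m] {L : Matrix m m ℝ}

theorem mulVec_apply (hL : IsLaplacian L) (x : m → ℝ) (i : m) :
    (L *ᵥ x) i = ∑ j, L i j * (x j - x i) := by
  simp only [mul_sub, Finset.sum_sub_distrib, ← Finset.sum_mul, hL.2 i, zero_mul, sub_zero]
  rfl

theorem mulVec_one (hL : IsLaplacian L) : L *ᵥ 1 = 0 := by
  ext i
  simp [hL.mulVec_apply]

/-- The maximum principle: `L x` is nonnegative where `x` is maximal. -/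
theorem mulVec_apply_nonneg (hL : IsLaplacian L) {x : m → ℝ} {i : m}
    (hi : ∀ j, x j ≤ x i) : 0 ≤ (L *ᵥ x) i := by
  rw [hL.mulVec_apply]
  refine Finset.sum_nonneg fun j _ => ?_
  obtain rfl | hij := eq_or_ne i j
  · simp
  · exact mul_nonneg_of_nonpos_of_nonpos (hL.1 i j hij) (sub_nonpos.2 (hi j))

/-- A constant vector in the range of a Laplacian matrix is zero. -/
theorem eq_zero_of_mulVec_eq_smul_one [Nonempty m] (hL : IsLaplacian L) {x : m → ℝ} {c : ℝ}
    (h : L *ᵥ x = c • 1) : c = 0 := by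
  obtain ⟨i, hi⟩ := Finite.exists_max x
  obtain ⟨j, hj⟩ := Finite.exists_max (-x)
  have h₁ := hL.mulVec_apply_nonneg hi
  have h₂ := hL.mulVec_apply_nonneg hj
  simp only [mulVec_neg, h, Pi.neg_apply, Pi.smul_apply, Pi.one_apply, smul_eq_mul,
    mul_one] at h₁ h₂
  linarith

theorem exists_smul_one_eq [Nonempty m] (hL : IsLaplacian L)
    (hker : Module.finrank ℝ (LinearMap.ker L.mulVecLin) = 1) {x : m → ℝ}
    (hx : L *ᵥ x = 0) : ∃ c : ℝ, x = c • 1 := by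
  let e : LinearMap.ker L.mulVecLin := ⟨1, hL.mulVec_one⟩
  have he : e ≠ 0 := fun h => one_ne_zero (congrArg Subtype.val h)
  obtain ⟨c, hc⟩ := (finrank_eq_one_iff_of_nonzero' e he).1 hker ⟨x, hx⟩
  exact ⟨c, (congrArg Subtype.val hc).symm⟩

/-- If the kernel of a Laplacian matrix is one-dimensional, then `0` is a semisimple eigenvalue. -/
theorem mulVec_eq_zero_of_pow_mulVec_eq_zero [Nonempty m] (hL : IsLaplacian L)
    (hker : Module.finrank ℝ (LinearMap.ker L.mulVecLin) = 1) (k : ℕ) {x : m → ℝ}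
    (hx : (L ^ k) *ᵥ x = 0) : L *ᵥ x = 0 := by
  induction k generalizing x with
  | zero => simp_all
  | succ k ih =>
    rw [pow_succ, ← mulVec_mulVec] at hx
    obtain ⟨c, hc⟩ := hL.exists_smul_one_eq hker (ih hx)
    rw [hc, hL.eq_zero_of_mulVec_eq_smul_one hc, zero_smul]

end IsLaplacian


/-- If the kernel of the Laplacian `L` is one-dimensional (the dependency digraph
has a spanning in-tree), then every latent consensus `𝟏 vᵀ L^⊢` coincides with
the ordinary consensus `L^⊢`. -/
theorem latent_consensus_eq_ordinary {n : ℕ} (L P : Matrix (Fin n) (Fin n) ℝ)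
    (hL : IsLaplacian L) (hP : IsEigenprojection L P)
    (hker : Module.finrank ℝ (LinearMap.ker L.mulVecLin) = 1) :
    ∀ v : Fin n → ℝ, (∀ i, 0 ≤ v i) → ∑ i, v i = 1 →
      vecMulVec 1 v * P = P := by
  intro v _ hv
  ext i j
  have : Nonempty (Fin n) := ⟨i⟩
  have hmem : P.mulVecLin (Pi.single j 1) ∈ LinearMap.ker (L ^ Fintype.card (Fin n)).mulVecLin :=
    hP.2.1 ▸ LinearMap.mem_range_self _ _
  obtain ⟨c, hc⟩ := hL.exists_smul_one_eq hker
    (hL.mulVec_eq_zero_of_pow_mulVec_eq_zero hker _ hmem)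
  have hcol : ∀ k, P k j = c := fun k => by simpa using congrFun hc k
  simp [mul_apply, hcol, ← Finset.sum_mul, hv]
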